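/- Suppose 1/2 < ω ≤ 1, where ω = sup{Re(s) : ζ(s) = 0}, and let c be a real number with c < 1 + ω. Then there exist arbitrarily large x such that ∫_2^x (π(t) − li(t))/t^c dt > 0. -/

import Mathlib

open MeasureTheory Filter

/-- `primePi x` is the number of primes `p ≤ x`. -/
noncomputable def primePi (x : ℝ) : ℝ := Nat.primeCounting ⌊x⌋₊

/-- `li x` is the logarithmic integral, defined for `x > 1` as the Cauchy principal value
`lim_{ε→0⁺} (∫_0^{1-ε} du/log u + ∫_{1+ε}^x du/log u)`. -/
noncomputable def li (x : ℝ) : ℝ :=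
  limUnder (nhdsWithin (0:ℝ) (Set.Ioi 0)) (fun ε =>
    (∫ u in (0:ℝ)..(1 - ε), 1 / Real.log u) + ∫ u in (1 + ε)..x, 1 / Real.log u)

/-- `omegaZ = sup {Re s : ζ(s) = 0}`. -/
noncomputable def omegaZ : ℝ := sSup {r : ℝ | ∃ s : ℂ, riemannZeta s = 0 ∧ s.re = r}


/-- the regularized integrand `1/log u - 1/(u-1)`. -/
noncomputable def hreg (u : ℝ) : ℝ := 1 / Real.log u - 1 / (u - 1)

lemma hreg_bound {u : ℝ} (hu : 0 < u) (hu1 : u ≠ 1) : 0 ≤ hreg u ∧ hreg u ≤ 1 := by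
  unfold hreg
  have h1 : Real.log u ≤ u - 1 := Real.log_le_sub_one_of_pos hu
  have h2 : 1 - u⁻¹ ≤ Real.log u := Real.one_sub_inv_le_log_of_pos hu
  have h3 : 1 - u⁻¹ = (u - 1) / u := by field_simp
  rw [h3] at h2
  have e : u / (u - 1) = 1 + 1 / (u - 1) := by
    have : u - 1 ≠ 0 := sub_ne_zero.mpr hu1
    field_simp; ring
  rcases lt_or_gt_of_ne hu1 with h | h
  · have hl : Real.log u < 0 := Real.log_neg hu h
    have a1 : 1 / (u - 1) ≤ 1 / Real.log u := 
      one_div_le_one_div_of_neg_of_le (by linarith) h1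
    have a2 : 1 / Real.log u ≤ 1 / ((u - 1) / u) :=
      one_div_le_one_div_of_neg_of_le hl h2
    rw [one_div_div, e] at a2
    constructor <;> linarith
  · have hl : 0 < Real.log u := Real.log_pos h
    have a1 : 1 / (u - 1) ≤ 1 / Real.log u := one_div_le_one_div_of_le hl h1
    have a2 : 1 / Real.log u ≤ 1 / ((u - 1) / u) :=
      one_div_le_one_div_of_le (div_pos (by linarith) hu) h2
    rw [one_div_div, e] at a2
    constructor <;> linarith

lemma hreg_meas : Measurable hreg := by
  unfold hreg; fun_prop

lemma hreg_ii {a b : ℝ} (ha : 0 ≤ a) (hb : 0 ≤ b) : IntervalIntegrable hreg volume a b := by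
  rw [intervalIntegrable_iff]
  refine MeasureTheory.Measure.integrableOn_of_bounded (M := 1) (by simp) hreg_meas.aestronglyMeasurable ?_
  have : ∀ᵐ u : ℝ ∂(volume.restrict (Set.uIoc a b)), u ≠ 1 :=
    ae_restrict_of_ae (Measure.ae_ne volume 1)
  filter_upwards [this, ae_restrict_mem measurableSet_uIoc] with u h1 h2
  have hu : 0 < u := lt_of_le_of_lt (le_min ha hb) h2.1
  have := hreg_bound hu h1
  rw [Real.norm_eq_abs, abs_of_nonneg this.1]
  exact this.2

lemma invsub_left {ε : ℝ} (h : 0 < ε) :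
    ∫ u in (0:ℝ)..(1 - ε), 1 / (u - 1) = Real.log ε := by
  have := intervalIntegral.integral_comp_sub_right (fun u : ℝ => 1 / u) (a := 0) (b := 1 - ε) 1
  rw [this, integral_one_div_of_neg (by norm_num) (by linarith)]
  congr 1
  ring

lemma invsub_right {ε x : ℝ} (h : 0 < ε) (h1 : 1 < x) :
    ∫ u in (1 + ε)..x, 1 / (u - 1) = Real.log (x - 1) - Real.log ε := by
  have := intervalIntegral.integral_comp_sub_right (fun u : ℝ => 1 / u) (a := 1 + ε) (b := x) 1
  rw [this, integral_one_div_of_pos (by linarith) (by linarith), Real.log_div (by linarith) (by linarith)]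
  congr 2
  ring

lemma invsub_ii {a b : ℝ} (h : (1:ℝ) ∉ Set.uIcc a b) :
    IntervalIntegrable (fun u : ℝ => 1 / (u - 1)) volume a b := by
  apply ContinuousOn.intervalIntegrable
  intro u hu
  have : u - 1 ≠ 0 := sub_ne_zero.mpr (by rintro rfl; exact h hu)
  have h2 : ContinuousAt (fun u : ℝ => 1 / (u - 1)) u := by fun_prop (disch := assumption)
  exact h2.continuousWithinAt

lemma log_split (u : ℝ) : 1 / Real.log u = hreg u + 1 / (u - 1) := by
  unfold hreg; ring

lemma li_eq {x : ℝ} (hx : 1 < x) : li x = (∫ u in (0:ℝ)..x, hreg u) + Real.log (x - 1) := by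
  unfold li
  apply Tendsto.limUnder_eq
  have key : ∀ᶠ ε in nhdsWithin (0:ℝ) (Set.Ioi 0),
      (∫ u in (0:ℝ)..(1 - ε), hreg u) + (∫ u in (1 + ε)..x, hreg u) + Real.log (x - 1) =
      (∫ u in (0:ℝ)..(1 - ε), 1 / Real.log u) + ∫ u in (1 + ε)..x, 1 / Real.log u := by
    have h1 : ∀ᶠ ε in nhdsWithin (0:ℝ) (Set.Ioi 0), ε < 1 :=
      nhdsWithin_le_nhds (Iio_mem_nhds one_pos)
    have h2 : ∀ᶠ ε in nhdsWithin (0:ℝ) (Set.Ioi 0), ε < x - 1 :=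
      nhdsWithin_le_nhds (Iio_mem_nhds (by linarith))
    filter_upwards [self_mem_nhdsWithin, h1, h2] with ε (h0 : 0 < ε) h1 h2
    simp_rw [log_split]
    rw [intervalIntegral.integral_add (hreg_ii le_rfl (by linarith)) (invsub_ii ?_),
      intervalIntegral.integral_add (hreg_ii (by linarith) (by linarith)) (invsub_ii ?_),
      invsub_left h0, invsub_right h0 hx]
    · ring
    · rw [Set.uIcc_of_le (by linarith)]; intro h; linarith [h.1]
    · rw [Set.uIcc_of_le (by linarith)]; intro h; linarith [h.2]
  refine Tendsto.congr' key ?_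
  have hc : ContinuousOn (fun y => ∫ u in (0:ℝ)..y, hreg u) (Set.uIcc 0 x) :=
    intervalIntegral.continuousOn_primitive_interval (by
      rw [Set.uIcc_of_le (by linarith), integrableOn_Icc_iff_integrableOn_Ioc,
        ← intervalIntegrable_iff_integrableOn_Ioc_of_le (by linarith)]
      exact hreg_ii le_rfl (by linarith))
  have hc1 : ContinuousAt (fun y => ∫ u in (0:ℝ)..y, hreg u) 1 := by
    apply hc.continuousAt
    rw [Set.uIcc_of_le (by linarith)]
    exact Icc_mem_nhds one_pos hx
  have l1 : Tendsto (fun ε : ℝ => ∫ u in (0:ℝ)..(1 - ε), hreg u) (nhdsWithin (0:ℝ) (Set.Ioi 0))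
      (nhds (∫ u in (0:ℝ)..1, hreg u)) := by
    refine hc1.tendsto.comp (tendsto_nhdsWithin_of_tendsto_nhds ?_)
    have : ContinuousAt (fun ε : ℝ => 1 - ε) 0 := by fun_prop
    simpa [ContinuousAt] using this
  have l2 : Tendsto (fun ε : ℝ => ∫ u in (0:ℝ)..(1 + ε), hreg u) (nhdsWithin (0:ℝ) (Set.Ioi 0))
      (nhds (∫ u in (0:ℝ)..1, hreg u)) := by
    refine hc1.tendsto.comp (tendsto_nhdsWithin_of_tendsto_nhds ?_)
    have : ContinuousAt (fun ε : ℝ => 1 + ε) 0 := by fun_prop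
    simpa [ContinuousAt] using this
  have l3 : Tendsto (fun ε : ℝ => ∫ u in (1 + ε)..x, hreg u) (nhdsWithin (0:ℝ) (Set.Ioi 0))
      (nhds ((∫ u in (0:ℝ)..x, hreg u) - (∫ u in (0:ℝ)..1, hreg u))) := by
    refine Tendsto.congr' ?_ (tendsto_const_nhds.sub l2)
    filter_upwards [self_mem_nhdsWithin] with ε (h0 : 0 < ε)
    rw [sub_eq_iff_eq_add, add_comm, intervalIntegral.integral_add_adjacent_intervals]
    · exact hreg_ii le_rfl (by linarith)
    · exact hreg_ii (by linarith) (by linarith)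
  have := (l1.add l3).add (tendsto_const_nhds (x := Real.log (x - 1)))
  simpa using this

lemma li_eq_add {x : ℝ} (hx : 2 ≤ x) : li x = li 2 + ∫ u in (2:ℝ)..x, 1 / Real.log u := by
  rw [li_eq (by linarith), li_eq (x := 2) (by norm_num)]
  simp_rw [log_split]
  have h1 : ∫ u in (2:ℝ)..x, 1 / (u - 1) = Real.log (x - 1) - Real.log 1 := by
    have := invsub_right (ε := 1) (x := x) one_pos (by linarith)
    rw [← this]; norm_num
  rw [intervalIntegral.integral_add (hreg_ii (by norm_num) (by linarith)) (invsub_ii ?_), h1,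
    ← intervalIntegral.integral_add_adjacent_intervals (b := 2) (hreg_ii le_rfl (by norm_num))
      (hreg_ii (by norm_num) (by linarith))]
  · norm_num; ring
  · rw [Set.uIcc_of_le (by linarith)]; intro h; linarith [h.1]

lemma fubini_aux (f : ℝ → ℝ) (hf : Measurable f) (C k : ℝ)
    (hb : ∀ t, 2 < t → |f t| ≤ C * t ^ k) (s : ℂ) (hs0 : 0 < s.re) (hs : k + 1 < s.re) :
    ∫ x in Set.Ioi (2:ℝ), ((∫ t in (2:ℝ)..x, f t : ℝ) : ℂ) * (x:ℂ) ^ (-s - 1) =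
      (∫ t in Set.Ioi (2:ℝ), (f t : ℂ) * (t:ℂ) ^ (-s)) / s := by
  set μ : Measure ℝ := volume.restrict (Set.Ioi 2) with hμ
  let g : ℝ → ℝ → ℂ := fun x t => Set.indicator (Set.Ioi t) (fun x : ℝ => (f t : ℂ) * (x:ℂ) ^ (-s - 1)) x
  have hgm : Measurable (fun p : ℝ × ℝ => g p.1 p.2) := by
    have : (fun p : ℝ × ℝ => g p.1 p.2) = Set.indicator {p : ℝ × ℝ | p.2 < p.1}
        (fun p => (f p.2 : ℂ) * (p.1:ℂ) ^ (-s - 1)) := by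
      ext p
      simp [g, Set.indicator]
    rw [this]
    refine Measurable.indicator ?_ (measurableSet_lt measurable_snd measurable_fst)
    fun_prop
  have hcpint : ∀ t, 2 < t → IntegrableOn (fun x : ℝ => (x:ℂ) ^ (-s - 1)) (Set.Ioi t) := by
    intro t ht
    exact integrableOn_Ioi_cpow_of_lt (by simp; linarith) (by linarith)
  have hintg : ∀ t, 2 < t → Integrable (fun x => g x t) μ := by
    intro t ht
    have : Integrable (fun x => g x t) volume := by
      simp only [g]
      rw [integrable_indicator_iff measurableSet_Ioi]
      exact (hcpint t ht).const_mul _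
    exact this.restrict
  have hres : ∀ t, 2 < t → ∀ φ : ℝ → ℂ, ∫ x, Set.indicator (Set.Ioi t) φ x ∂μ = ∫ x in Set.Ioi t, φ x := by
    intro t ht φ
    rw [integral_indicator measurableSet_Ioi, hμ, Measure.restrict_restrict measurableSet_Ioi]
    congr 2
    ext x; simp; intro h; linarith
  have hval : ∀ t, 2 < t → ∫ x, g x t ∂μ = (f t : ℂ) * (t:ℂ) ^ (-s) / s := by
    intro t ht
    simp only [g]
    rw [hres t ht, integral_const_mul, integral_Ioi_cpow_of_lt (by simp; linarith) (by linarith)]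
    have : s ≠ 0 := by rintro rfl; simp at hs0
    simp only [sub_add_cancel]
    field_simp
  have hnorm : ∀ t, 2 < t → ∫ x, ‖g x t‖ ∂μ = |f t| * (t ^ (-s.re) / s.re) := by
    intro t ht
    have e : ∀ x, ‖g x t‖ = Set.indicator (Set.Ioi t) (fun x : ℝ => |f t| * x ^ (-s.re - 1)) x := by
      intro x
      by_cases h : t < x
      · have hx : 0 < x := by linarith
        simp [g, Set.indicator, h, Complex.norm_cpow_eq_rpow_re_of_pos hx]
      · simp [g, Set.indicator, h]
    simp_rw [e]
    rw [integral_indicator measurableSet_Ioi, hμ, Measure.restrict_restrict measurableSet_Ioi]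
    have : Set.Ioi t ∩ Set.Ioi 2 = Set.Ioi t := by ext x; simp; intro h; linarith
    rw [this, integral_const_mul, integral_Ioi_rpow_of_lt (by linarith) (by linarith)]
    simp only [sub_add_cancel]
    rw [neg_div_neg_eq]
  have hI : Integrable (fun p : ℝ × ℝ => g p.1 p.2) (μ.prod μ) := by
    rw [integrable_prod_iff' hgm.aestronglyMeasurable]
    constructor
    · filter_upwards [ae_restrict_mem measurableSet_Ioi] with t ht using hintg t ht
    · have h1 : Integrable (fun t : ℝ => C / s.re * t ^ (k - s.re)) μ :=
        (integrableOn_Ioi_rpow_of_lt (by linarith) (by norm_num : (0:ℝ) < 2)).const_mul _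
      refine h1.mono ?_ ?_
      · exact (hgm.norm.stronglyMeasurable.integral_prod_left'
          (μ := μ) (f := fun p : ℝ × ℝ => ‖g p.1 p.2‖)).aestronglyMeasurable
      · filter_upwards [ae_restrict_mem measurableSet_Ioi] with t (ht : 2 < t)
        have t0 : 0 < t := by linarith
        rw [hnorm t ht, Real.norm_eq_abs, abs_of_nonneg (by positivity)]
        refine le_trans ?_ (le_abs_self _)
        rw [sub_eq_add_neg, Real.rpow_add t0]
        calc |f t| * (t ^ (-s.re) / s.re) ≤ (C * t ^ k) * (t ^ (-s.re) / s.re) := by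
              gcongr; exact hb t ht
          _ = _ := by ring
  have hsw := integral_integral_swap (f := g) hI
  have hL : ∫ x, ∫ t, g x t ∂μ ∂μ = ∫ x in Set.Ioi (2:ℝ), ((∫ t in (2:ℝ)..x, f t : ℝ) : ℂ) * (x:ℂ) ^ (-s - 1) := by
    refine setIntegral_congr_fun measurableSet_Ioi ?_
    intro x (hx : 2 < x)
    have e : ∀ t, g x t = Set.indicator (Set.Iio x) (fun t => (f t : ℂ) * (x:ℂ) ^ (-s - 1)) t := by
      intro t; simp [g, Set.indicator]
    simp_rw [e]
    rw [integral_indicator measurableSet_Iio, hμ, Measure.restrict_restrict measurableSet_Iio]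
    have : Set.Iio x ∩ Set.Ioi 2 = Set.Ioo 2 x := by ext y; simp [and_comm]
    rw [this, integral_mul_const, intervalIntegral.integral_of_le hx.le,
      ← integral_Ioc_eq_integral_Ioo, integral_complex_ofReal]
  have hR : ∫ t, ∫ x, g x t ∂μ ∂μ = (∫ t in Set.Ioi (2:ℝ), (f t : ℂ) * (t:ℂ) ^ (-s)) / s := by
    rw [← integral_div]
    exact setIntegral_congr_fun measurableSet_Ioi (fun t ht => hval t ht)
  rw [← hL, ← hR, hsw]

/-- Convergence of the transform at the real point `σ`. -/
def Conv (G : ℝ → ℝ) (σ : ℝ) : Prop :=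
  IntegrableOn (fun t : ℝ => G t * t ^ (-σ - 1)) (Set.Ioi 1)

/-- The transform. -/
noncomputable def Phi (G : ℝ → ℝ) (s : ℂ) : ℂ :=
  ∫ t in Set.Ioi (1:ℝ), (G t : ℂ) * (t:ℂ) ^ (-s - 1)

/-- Taylor coefficients of the transform. -/
noncomputable def PhiCoef (G : ℝ → ℝ) (b : ℂ) (n : ℕ) : ℂ :=
  ∫ t in Set.Ioi (1:ℝ), (G t : ℂ) * (t:ℂ) ^ (-b - 1) * ((-(Real.log t : ℂ)) ^ n / (n.factorial : ℂ))

lemma Conv.mono {G : ℝ → ℝ} (hGm : Measurable G) {σ σ' : ℝ} (h : Conv G σ)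
    (hle : σ ≤ σ') : Conv G σ' := by
  unfold Conv at *
  refine Integrable.mono h (by fun_prop) ?_
  filter_upwards [ae_restrict_mem measurableSet_Ioi] with t (ht : 1 < t)
  rw [norm_mul, norm_mul, Real.norm_of_nonneg (by positivity : 0 ≤ t ^ (-σ' - 1)),
    Real.norm_of_nonneg (by positivity : 0 ≤ t ^ (-σ - 1))]
  gcongr
  · exact ht.le

lemma rexp_hasSum (x : ℝ) : HasSum (fun n : ℕ => x ^ n / (n.factorial : ℝ)) (Real.exp x) := by
  rw [Real.exp_eq_exp_ℝ]; exact NormedSpace.expSeries_div_hasSum_exp x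

lemma cexp_hasSum (x : ℂ) : HasSum (fun n : ℕ => x ^ n / (n.factorial : ℂ)) (Complex.exp x) := by
  rw [Complex.exp_eq_exp_ℂ]; exact NormedSpace.expSeries_div_hasSum_exp x

lemma rpow_add_exp {t : ℝ} (ht : 0 < t) (a r : ℝ) : t ^ (a + r) = t ^ a * Real.exp (r * Real.log t) := by
  rw [Real.rpow_add ht, Real.rpow_def_of_pos ht r, mul_comm r]

lemma cpow_add_exp {t : ℝ} (ht : 0 < t) (a z : ℂ) :
    (t:ℂ) ^ (a + z) = (t:ℂ) ^ a * Complex.exp (z * (Real.log t : ℂ)) := by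
  have h : (t:ℂ) ≠ 0 := by exact_mod_cast ht.ne'
  rw [Complex.cpow_add _ _ h, Complex.cpow_def_of_ne_zero h z, mul_comm z, Complex.ofReal_log ht.le]

lemma Phi_hasSum {G : ℝ → ℝ} (hGm : Measurable G) (hG0 : ∀ t, 0 ≤ G t) {σ : ℝ}
    (h : Conv G σ) {b z : ℂ} (hz : ‖z‖ ≤ b.re - σ) :
    HasSum (fun n => z ^ n * PhiCoef G b n) (Phi G (b + z)) := by
  have hr : 0 ≤ b.re - σ := (norm_nonneg _).trans hz
  set r := b.re - σ with hrdef
  have e1 : ∀ n, z ^ n * PhiCoef G b n = ∫ t in Set.Ioi (1:ℝ),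
      (G t : ℂ) * (t:ℂ) ^ (-b - 1) * ((-z * (Real.log t : ℂ)) ^ n / (n.factorial : ℂ)) := by
    intro n
    unfold PhiCoef
    rw [← integral_const_mul]
    congr 1; ext t
    rw [neg_mul, ← mul_neg, mul_pow]; ring
  simp_rw [e1]
  unfold Phi
  have hsum : ∀ t : ℝ, 1 < t → HasSum (fun n : ℕ => G t * t ^ (-b.re - 1) * ((r * Real.log t) ^ n / (n.factorial : ℝ)))
      (G t * t ^ (-σ - 1)) := by
    intro t ht
    have := (rexp_hasSum (r * Real.log t)).mul_left (G t * t ^ (-b.re - 1))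
    convert! this using 1
    rw [mul_assoc, ← rpow_add_exp (by linarith)]
    congr 2; rw [hrdef]; ring
  refine hasSum_integral_of_dominated_convergence
    (fun n t => G t * t ^ (-b.re - 1) * ((r * Real.log t) ^ n / (n.factorial : ℝ))) ?_ ?_ ?_ ?_ ?_
  · intro n; 
    have : Measurable (fun t : ℝ => (G t : ℂ) * (t:ℂ) ^ (-b - 1) * ((-z * (Real.log t : ℂ)) ^ n / (n.factorial : ℂ))) := by
      fun_prop
    exact this.aestronglyMeasurable
  · intro n
    filter_upwards [ae_restrict_mem measurableSet_Ioi] with t (ht : 1 < t)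
    have hl : 0 ≤ Real.log t := Real.log_nonneg ht.le
    rw [norm_mul, norm_mul, Complex.norm_cpow_eq_rpow_re_of_pos (by linarith), norm_div, norm_pow, norm_mul,
      norm_neg, Complex.norm_real, Complex.norm_real, Real.norm_of_nonneg (hG0 t), Real.norm_of_nonneg hl]
    simp only [Complex.norm_natCast, Complex.sub_re, Complex.neg_re, Complex.one_re]
    have := hG0 t
    gcongr
  · filter_upwards [ae_restrict_mem measurableSet_Ioi] with t ht using (hsum t ht).summable
  · refine Integrable.congr h ?_
    filter_upwards [ae_restrict_mem measurableSet_Ioi] with t ht using (hsum t ht).tsum_eq.symm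
  · filter_upwards [ae_restrict_mem measurableSet_Ioi] with t (ht : 1 < t)
    have := (cexp_hasSum (-z * (Real.log t : ℂ))).mul_left ((G t : ℂ) * (t:ℂ) ^ (-b - 1))
    convert! this using 1
    rw [mul_assoc, ← cpow_add_exp (by linarith)]
    congr 2; ring

lemma Phi_hasFPower {G : ℝ → ℝ} (hGm : Measurable G) (hG0 : ∀ t, 0 ≤ G t) {σ : ℝ}
    (h : Conv G σ) {b : ℂ} (hb : σ < b.re) :
    HasFPowerSeriesAt (Phi G) (FormalMultilinearSeries.ofScalars ℂ (PhiCoef G b)) b := by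
  rw [hasFPowerSeriesAt_iff]
  filter_upwards [Metric.ball_mem_nhds (0:ℂ) (sub_pos.mpr hb)] with z hz
  simp only [FormalMultilinearSeries.coeff_ofScalars, smul_eq_mul]
  exact Phi_hasSum hGm hG0 h (by simpa using (mem_ball_zero_iff.mp hz).le)

lemma Phi_differentiableAt {G : ℝ → ℝ} (hGm : Measurable G) (hG0 : ∀ t, 0 ≤ G t) {σ : ℝ}
    (h : Conv G σ) {b : ℂ} (hb : σ < b.re) : DifferentiableAt ℂ (Phi G) b :=
  (Phi_hasFPower hGm hG0 h hb).differentiableAt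

lemma landau_step {G : ℝ → ℝ} (hGm : Measurable G) (hG0 : ∀ t, 0 ≤ G t) {σ b R : ℝ}
    (h : Conv G σ) (hb : σ < b) {Ψ : ℂ → ℂ} (hΨ : DifferentiableOn ℂ Ψ (Metric.ball (b:ℂ) R))
    (heq : Ψ =ᶠ[nhds (b:ℂ)] Phi G) {ρ : ℝ} (hρ0 : 0 < ρ) (hρ : ρ < R) : Conv G (b - ρ) := by
  obtain ⟨R', hR1, hR2⟩ := exists_between hρ
  have hR'0 : 0 < R' := by linarith
  lift R' to NNReal using hR'0.le
  have hps := (hΨ.mono (Metric.closedBall_subset_ball hR2)).hasFPowerSeriesOnBall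
    (by exact_mod_cast hR'0)
  have hp2 := (Phi_hasFPower hGm hG0 h (b := (b:ℂ)) (by simpa using hb)).congr heq.symm
  have hpe := hps.hasFPowerSeriesAt.eq_formalMultilinearSeries hp2
  rw [hpe] at hps
  have hs := (hps.hasSum (y := (-ρ : ℂ)) (by
    simp only [Metric.mem_eball, edist_zero_right]
    rw [enorm_lt_coe, ← NNReal.coe_lt_coe]
    simpa [abs_of_pos hρ0] using hR1)).summable
  set c : ℕ → ℝ → ℝ := fun n t => G t * t ^ (-b - 1) * ((ρ * Real.log t) ^ n / (n.factorial : ℝ)) with hc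
  have hterm : ∀ n, (FormalMultilinearSeries.ofScalars ℂ (PhiCoef G (b:ℂ)) n fun _ => (-ρ : ℂ)) =
      ((∫ t in Set.Ioi (1:ℝ), c n t : ℝ) : ℂ) := by
    intro n
    rw [FormalMultilinearSeries.apply_eq_pow_smul_coeff, FormalMultilinearSeries.coeff_ofScalars,
      smul_eq_mul, PhiCoef, ← integral_const_mul, ← integral_complex_ofReal]
    refine setIntegral_congr_fun measurableSet_Ioi ?_
    intro t (ht : 1 < t)
    simp only [hc]
    push_cast
    rw [Complex.ofReal_cpow (by linarith)]
    push_cast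
    rw [← neg_mul_neg (ρ:ℂ), mul_pow]; ring
  simp_rw [hterm] at hs
  have hs' : Summable (fun n => ∫ t in Set.Ioi (1:ℝ), c n t) := by exact_mod_cast hs
  have hcm : ∀ n, Measurable (c n) := by intro n; simp only [hc]; fun_prop
  have hc0 : ∀ n t, 1 < t → 0 ≤ c n t := by
    intro n t ht
    have := hG0 t
    have := Real.log_nonneg ht.le
    simp only [hc]; positivity
  have hci : ∀ n, IntegrableOn (c n) (Set.Ioi 1) := by
    intro n
    have hr : 0 < b - σ := by linarith
    refine Integrable.mono' (Integrable.const_mul h ((ρ / (b - σ)) ^ n)) (hcm n).aestronglyMeasurable ?_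
    filter_upwards [ae_restrict_mem measurableSet_Ioi] with t (ht : 1 < t)
    rw [Real.norm_of_nonneg (hc0 n t ht)]
    have hl := Real.log_nonneg ht.le
    have h1 : ((b - σ) * Real.log t) ^ n / (n.factorial : ℝ) ≤ Real.exp ((b - σ) * Real.log t) :=
      Real.pow_div_factorial_le_exp _ (by positivity) n
    have h2 : t ^ (-σ - 1) = t ^ (-b - 1) * Real.exp ((b - σ) * Real.log t) := by
      rw [← rpow_add_exp (by linarith)]; congr 1; ring
    rw [h2]
    have h3 : c n t = (ρ / (b - σ)) ^ n * (G t * (t ^ (-b - 1) * (((b - σ) * Real.log t) ^ n / (n.factorial : ℝ)))) := by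
      simp only [hc]
      rw [mul_pow, mul_pow, div_pow]
      field_simp
    rw [h3]
    have := hG0 t
    gcongr
  unfold Conv
  refine ⟨by fun_prop, ?_⟩
  rw [hasFiniteIntegral_iff_ofReal]
  · have e : ∀ t ∈ Set.Ioi (1:ℝ), ENNReal.ofReal (G t * t ^ (-(b - ρ) - 1)) = ∑' n, ENNReal.ofReal (c n t) := by
      intro t (ht : 1 < t)
      have hS : HasSum (fun n => c n t) (G t * t ^ (-(b - ρ) - 1)) := by
        have := (rexp_hasSum (ρ * Real.log t)).mul_left (G t * t ^ (-b - 1))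
        convert! this using 1
        rw [mul_assoc, ← rpow_add_exp (by linarith)]
        congr 2; ring
      rw [← hS.tsum_eq, ENNReal.ofReal_tsum_of_nonneg (fun n => hc0 n t ht) hS.summable]
    rw [setLIntegral_congr_fun measurableSet_Ioi e, lintegral_tsum (fun n => (hcm n).ennreal_ofReal.aemeasurable)]
    have e2 : ∀ n, ∫⁻ t in Set.Ioi (1:ℝ), ENNReal.ofReal (c n t) = ENNReal.ofReal (∫ t in Set.Ioi (1:ℝ), c n t) := by
      intro n
      rw [ofReal_integral_eq_lintegral_ofReal (hci n)]
      filter_upwards [ae_restrict_mem measurableSet_Ioi] with t ht using hc0 n t ht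
    simp_rw [e2]
    rw [← ENNReal.ofReal_tsum_of_nonneg _ hs']
    · exact ENNReal.ofReal_lt_top
    · intro n
      exact setIntegral_nonneg measurableSet_Ioi (fun t ht => hc0 n t ht)
  · filter_upwards [ae_restrict_mem measurableSet_Ioi] with t (ht : 1 < t)
    have := hG0 t
    show 0 ≤ G t * t ^ (-(b - ρ) - 1)
    positivity

lemma isPreconnected_re_gt (a : ℝ) : IsPreconnected {s : ℂ | a < s.re} :=
  (convex_halfSpace_re_gt a).isPreconnected

lemma isOpen_re_gt (a : ℝ) : IsOpen {s : ℂ | a < s.re} :=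
  isOpen_lt continuous_const Complex.continuous_re

/-- Identity theorem on half planes. -/
lemma eq_of_eq_halfplane {f g : ℂ → ℂ} {a a' : ℝ}
    (hf : DifferentiableOn ℂ f {s : ℂ | a < s.re}) (hg : DifferentiableOn ℂ g {s : ℂ | a < s.re})
    (h : ∀ s : ℂ, a' < s.re → f s = g s) : ∀ s : ℂ, a < s.re → f s = g s := by
  have hf' := hf.analyticOnNhd (isOpen_re_gt a)
  have hg' := hg.analyticOnNhd (isOpen_re_gt a)
  set z0 : ℂ := ((max a a' + 1 : ℝ) : ℂ) with hz0
  have h0 : a < z0.re := by simp [hz0]; linarith [le_max_left a a']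
  have h0' : a' < z0.re := by simp [hz0]; linarith [le_max_right a a']
  have := hf'.eqOn_of_preconnected_of_eventuallyEq hg' (isPreconnected_re_gt a) (z₀ := z0) h0
    (by filter_upwards [(isOpen_re_gt a').mem_nhds h0'] with s hs using h s hs)
  exact fun s hs => this hs

theorem landau_exp {G : ℝ → ℝ} (hGm : Measurable G) (hG0 : ∀ t, 0 ≤ G t) (s0 s1 : ℝ)
    (hconv : ∀ σ, s1 < σ → Conv G σ) (A B K : ℂ → ℂ)
    (hA : DifferentiableOn ℂ A {s : ℂ | s0 < s.re}) (hB : DifferentiableOn ℂ B {s : ℂ | s0 < s.re})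
    (hK : DifferentiableOn ℂ K {s : ℂ | s0 < s.re})
    (hB0 : ∀ s : ℂ, s0 < s.re → B s ≠ 0) (hK0 : ∀ σ : ℝ, s0 < σ → K σ ≠ 0)
    (h : ∀ s : ℂ, s1 < s.re → Complex.exp (A s + B s * Phi G s) = K s) :
    ∀ s : ℂ, s0 < s.re → K s ≠ 0 := by
  -- the extended identity
  have ext : ∀ a, s0 ≤ a → (∀ σ, a < σ → Conv G σ) →
      (DifferentiableOn ℂ (fun s => A s + B s * Phi G s) {s : ℂ | a < s.re}) ∧
      ∀ s : ℂ, a < s.re → Complex.exp (A s + B s * Phi G s) = K s := by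
    intro a ha hc
    have hsub : {s : ℂ | a < s.re} ⊆ {s : ℂ | s0 < s.re} := fun s (hs : a < s.re) => lt_of_le_of_lt ha hs
    have hP : DifferentiableOn ℂ (Phi G) {s : ℂ | a < s.re} := by
      intro s (hs : a < s.re)
      obtain ⟨σ, h1, h2⟩ := exists_between hs
      exact (Phi_differentiableAt hGm hG0 (hc σ h1) h2).differentiableWithinAt
    have hD := (hA.mono hsub).add ((hB.mono hsub).mul hP)
    exact ⟨hD, eq_of_eq_halfplane hD.cexp (hK.mono hsub) h⟩
  suffices hall : ∀ σ, s0 < σ → Conv G σ by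
    intro s hs
    rw [← (ext s0 le_rfl hall).2 s hs]
    exact Complex.exp_ne_zero _
  by_contra hcon
  push Not at hcon
  obtain ⟨σ0, hσ0, hnc⟩ := hcon
  set S : Set ℝ := {σ | Conv G σ} with hS
  have hlb : ∀ σ ∈ S, σ0 ≤ σ := by
    intro σ hσ
    by_contra hlt
    exact hnc (Conv.mono hGm hσ (not_le.mp hlt).le)
  have hbdd : BddBelow S := ⟨σ0, hlb⟩
  have hne : S.Nonempty := ⟨s1 + 1, hconv _ (by linarith)⟩
  set a := sInf S with ha
  have haσ : σ0 ≤ a := le_csInf hne hlb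
  have hca : ∀ σ, a < σ → Conv G σ := by
    intro σ hσ
    obtain ⟨τ, hτ, hlt⟩ := exists_lt_of_csInf_lt hne hσ
    exact Conv.mono hGm hτ hlt.le
  obtain ⟨hD, hE⟩ := ext a (by linarith) hca
  set D : ℂ → ℂ := fun s => A s + B s * Phi G s with hDdef
  have has : s0 < (a:ℂ).re := by simp; linarith
  -- ball where K is nonzero
  have hKc : ContinuousAt K (a:ℂ) := (hK.differentiableAt ((isOpen_re_gt s0).mem_nhds has)).continuousAt
  have hev : ∀ᶠ s in nhds (a:ℂ), K s ≠ 0 ∧ s0 < s.re :=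
    (hKc.eventually_ne (hK0 a (by linarith))).and ((isOpen_re_gt s0).mem_nhds has)
  obtain ⟨δ, hδ, hball⟩ := Metric.eventually_nhds_iff_ball.mp hev
  have hKb : DifferentiableOn ℂ K (Metric.ball (a:ℂ) δ) := hK.mono (fun s hs => (hball s hs).2)
  have hlog : DifferentiableOn ℂ (fun s => deriv K s / K s) (Metric.ball (a:ℂ) δ) :=
    (hKb.deriv Metric.isOpen_ball).div hKb (fun s hs => (hball s hs).1)
  set b : ℝ := a + δ / 4 with hb
  obtain ⟨g, hgb, hg⟩ := hlog.isExactOn_ball.with_val_at (b:ℂ) (D b)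
  set V : Set ℂ := Metric.ball (a:ℂ) δ ∩ {s : ℂ | a < s.re} with hV
  have hVo : IsOpen V := Metric.isOpen_ball.inter (isOpen_re_gt a)
  have hVc : IsPreconnected V := ((convex_ball _ _).inter (convex_halfSpace_re_gt a)).isPreconnected
  have hbV : (b:ℂ) ∈ V := by
    refine ⟨?_, ?_⟩
    · rw [Metric.mem_ball, Complex.dist_eq, hb]
      push_cast
      rw [add_sub_cancel_left]
      have : ‖((δ/4 : ℝ) : ℂ)‖ < δ := by
        rw [Complex.norm_real, Real.norm_of_nonneg (by positivity)]; linarith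
      simpa using this
    · simp [hb]; linarith
  have hDV : DifferentiableOn ℂ D V := hD.mono Set.inter_subset_right
  have hgV : DifferentiableOn ℂ g V := fun s hs => (hg s hs.1).differentiableAt.differentiableWithinAt
  have hderiv : Set.EqOn (deriv D) (deriv g) V := by
    intro s hs
    rw [(hg s hs.1).deriv]
    have h1 : HasDerivAt D (deriv D s) s := (hDV.differentiableAt (hVo.mem_nhds hs)).hasDerivAt
    have h2 := h1.cexp
    have h3 : K =ᶠ[nhds s] fun s => Complex.exp (D s) := by
      filter_upwards [hVo.mem_nhds hs] with z hz using (hE z hz.2).symm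
    rw [h3.deriv_eq, h2.deriv, ← hE s hs.2, mul_div_cancel_left₀ _ (Complex.exp_ne_zero _)]
  have hDg : Set.EqOn D g V := hVo.eqOn_of_deriv_eq hVc hDV hgV hderiv hbV hgb.symm
  have hcσ : Conv G (a + δ / 8) := hca _ (by linarith)
  have hΨ : DifferentiableOn ℂ (fun s => (g s - A s) / B s) (Metric.ball (b:ℂ) (δ / 2)) := by
    have hsub : Metric.ball (b:ℂ) (δ / 2) ⊆ Metric.ball (a:ℂ) δ := by
      apply Metric.ball_subset_ball'
      rw [Complex.dist_eq, hb]
      push_cast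
      rw [add_sub_cancel_left]
      have : ‖((δ/4 : ℝ) : ℂ)‖ = δ / 4 := by
        rw [Complex.norm_real, Real.norm_of_nonneg (by positivity)]
      push_cast at this
      rw [this]; linarith
    have hg' : DifferentiableOn ℂ g (Metric.ball (b:ℂ) (δ / 2)) :=
      fun s hs => (hg s (hsub hs)).differentiableAt.differentiableWithinAt
    have h2 : Metric.ball (b:ℂ) (δ / 2) ⊆ {s : ℂ | s0 < s.re} := fun s hs => (hball s (hsub hs)).2
    exact (hg'.sub (hA.mono h2)).div (hB.mono h2) (fun s hs => hB0 s (h2 hs))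
  have hfin := landau_step hGm hG0 (b := b) (σ := a + δ / 8) (R := δ / 2) hcσ (by linarith) hΨ
    (by
      filter_upwards [hVo.mem_nhds hbV] with s hs
      rw [← hDg hs, hDdef]
      have := hB0 s (hball s hs.1).2
      field_simp
      ring) (ρ := 3 * δ / 8) (by linarith) (by linarith)
  have : a ≤ b - 3 * δ / 8 := csInf_le hbdd hfin
  linarith

lemma conv_of_bound {G : ℝ → ℝ} (hGm : Measurable G) {C k σ : ℝ} 
    (hb : ∀ t, 1 < t → |G t| ≤ C * t ^ k) (hσ : k < σ) : Conv G σ := by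
  unfold Conv
  have h1 : IntegrableOn (fun t : ℝ => C * t ^ (k - σ - 1)) (Set.Ioi 1) :=
    (integrableOn_Ioi_rpow_of_lt (by linarith) one_pos).const_mul _
  refine Integrable.mono' h1 (by fun_prop) ?_
  filter_upwards [ae_restrict_mem measurableSet_Ioi] with t (ht : 1 < t)
  rw [norm_mul, Real.norm_eq_abs, Real.norm_of_nonneg (by positivity)]
  calc |G t| * t ^ (-σ - 1) ≤ C * t ^ k * t ^ (-σ - 1) := by gcongr; exact hb t ht
    _ = C * t ^ (k - σ - 1) := by
      rw [mul_assoc, ← Real.rpow_add (by linarith)]; congr 2; ring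

lemma Phi_integrable {G : ℝ → ℝ} (hGm : Measurable G) {s : ℂ} (h : Conv G s.re) :
    IntegrableOn (fun t : ℝ => (G t : ℂ) * (t:ℂ) ^ (-s - 1)) (Set.Ioi 1) := by
  refine Integrable.mono h (Measurable.aestronglyMeasurable (by fun_prop)) ?_
  filter_upwards [ae_restrict_mem measurableSet_Ioi] with t (ht : 1 < t)
  rw [norm_mul, norm_mul, Complex.norm_cpow_eq_rpow_re_of_pos (by linarith), Complex.norm_real,
    Real.norm_of_nonneg (by positivity : 0 ≤ t ^ (-s.re - 1))]
  simp

lemma conv_fract {σ : ℝ} (h : 0 < σ) : Conv (fun t => Int.fract t) σ := by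
  refine conv_of_bound (C := 1) (k := 0) measurable_fract ?_ h
  intro t _
  rw [abs_of_nonneg (Int.fract_nonneg t)]
  simpa using (Int.fract_lt_one t).le

lemma zeta_fract {w : ℂ} (hw : 1 < w.re) :
    riemannZeta w = w / (w - 1) - w * Phi (fun t => Int.fract t) w := by
  have h1 := LSeries_eq_mul_integral_of_nonneg (fun _ => (1:ℝ)) (r := 1) zero_le_one (s := w) hw
    (by
      simp only [Finset.sum_const, Nat.card_Icc, add_tsub_cancel_right, nsmul_eq_mul, mul_one, Real.rpow_one]
      exact Asymptotics.isBigO_refl _ _) (fun _ => zero_le_one)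
  have h2 : LSeries (fun _ : ℕ => ((1:ℝ):ℂ)) w = riemannZeta w := by
    have := LSeries_one_eq_riemannZeta hw
    rw [← this]; congr 1
  rw [← h2, h1]
  have hne : w - 1 ≠ 0 := by
    intro h; have : w = 1 := sub_eq_zero.mp h
    rw [this] at hw; simp at hw
  have hi1 : IntegrableOn (fun t : ℝ => (t:ℂ) ^ (-w)) (Set.Ioi 1) :=
    integrableOn_Ioi_cpow_of_lt (by simpa using hw) one_pos
  have hi2 := Phi_integrable (G := fun t => Int.fract t) measurable_fract (s := w) (conv_fract (by linarith))
  have h3 : ∫ t in Set.Ioi (1 : ℝ), (∑ k ∈ Finset.Icc 1 ⌊t⌋₊, ((1:ℝ) : ℂ)) * (t:ℂ) ^ (-(w + 1)) =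
      (∫ t in Set.Ioi (1:ℝ), (t:ℂ) ^ (-w)) - Phi (fun t => Int.fract t) w := by
    unfold Phi
    rw [← integral_sub hi1 hi2]
    refine setIntegral_congr_fun measurableSet_Ioi ?_
    intro t (ht : 1 < t)
    have ht0 : (t:ℂ) ≠ 0 := by exact_mod_cast (by linarith : t ≠ 0)
    have e1 : (t:ℂ) ^ (-w) = t * (t:ℂ) ^ (-(w+1)) := by
      rw [neg_add, ← sub_eq_add_neg, Complex.cpow_sub _ _ ht0, Complex.cpow_one]; field_simp
    have e2 : -w - 1 = -(w + 1) := by ring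
    have e3 : (⌊t⌋₊ : ℝ) = t - Int.fract t := by
      rw [natCast_floor_eq_intCast_floor (by linarith), Int.self_sub_fract]
    have e4 : ((⌊t⌋₊ : ℕ) : ℂ) = (t:ℂ) - (Int.fract t : ℝ) := by
      rw [← Complex.ofReal_sub, ← e3]; simp
    simp only [Finset.sum_const, Nat.card_Icc, add_tsub_cancel_right, nsmul_eq_mul, mul_one, Complex.ofReal_one]
    rw [e1, e2, e4]; ring
  rw [h3, integral_Ioi_cpow_of_lt (by simpa using hw) one_pos]
  have : -w + 1 ≠ 0 := by intro h; apply hne; linear_combination -h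
  simp only [Complex.ofReal_one, Complex.one_cpow]
  have e5 : (-1 : ℂ) / (-w + 1) = 1 / (w - 1) := by
    field_simp; ring
  rw [e5]; ring

lemma zeta1_fract {w : ℂ} (hw : 0 < w.re) :
    riemannZeta₁ w = w - w * (w - 1) * Phi (fun t => Int.fract t) w := by
  have hP : DifferentiableOn ℂ (Phi (fun t => Int.fract t)) {s : ℂ | 0 < s.re} := by
    intro s (hs : 0 < s.re)
    obtain ⟨σ, h1, h2⟩ := exists_between hs
    exact (Phi_differentiableAt measurable_fract Int.fract_nonneg (conv_fract h1) h2).differentiableWithinAt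
  have hg : DifferentiableOn ℂ (fun w => w - w * (w - 1) * Phi (fun t => Int.fract t) w) {s : ℂ | 0 < s.re} :=
    differentiableOn_id.sub ((differentiableOn_id.mul (differentiableOn_id.sub_const 1)).mul hP)
  refine eq_of_eq_halfplane (a' := 1) differentiable_riemannZeta₁.differentiableOn hg ?_ w hw
  intro s hs
  have hne : s ≠ 1 := by rintro rfl; simp at hs
  have h1 := riemannZeta_eq_inv_sub_mul hne
  rw [zeta_fract hs] at h1
  have : s - 1 ≠ 0 := sub_ne_zero.mpr hne
  field_simp at h1
  rw [← h1]; ring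

lemma zeta1_ne_zero_real {σ : ℝ} (hσ : 0 < σ) : riemannZeta₁ (σ:ℂ) ≠ 0 := by
  rcases lt_or_ge 1 σ with h | h
  · intro h0
    have hne : (σ:ℂ) ≠ 1 := by exact_mod_cast h.ne'
    have := riemannZeta_eq_inv_sub_mul hne
    rw [h0, mul_zero] at this
    exact riemannZeta_ne_zero_of_one_le_re (by simpa using h.le) this
  · rw [zeta1_fract (by simpa using hσ)]
    have e : Phi (fun t => Int.fract t) (σ:ℂ) =
        ((∫ t in Set.Ioi (1:ℝ), Int.fract t * t ^ (-σ - 1) : ℝ) : ℂ) := by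
      unfold Phi
      rw [← integral_complex_ofReal]
      refine setIntegral_congr_fun measurableSet_Ioi ?_
      intro t (ht : 1 < t)
      dsimp only
      rw [Complex.ofReal_mul, Complex.ofReal_cpow (by linarith)]
      push_cast; rfl
    rw [e]
    have h0 : 0 ≤ ∫ t in Set.Ioi (1:ℝ), Int.fract t * t ^ (-σ - 1) := by
      refine setIntegral_nonneg measurableSet_Ioi (fun t (ht : 1 < t) => ?_)
      have := Int.fract_nonneg t
      positivity
    set I := ∫ t in Set.Ioi (1:ℝ), Int.fract t * t ^ (-σ - 1)
    have h2 : 0 < σ - σ * (σ - 1) * I := by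
      have : 0 ≤ σ * (1 - σ) * I := mul_nonneg (mul_nonneg hσ.le (by linarith)) h0
      linarith
    exact_mod_cast h2.ne'

/-- `∑_p (-log(1-p^{-w}) - p^{-w})`. -/
noncomputable def Rfun (w : ℂ) : ℂ :=
  ∑' p : Nat.Primes, (-Complex.log (1 - (p:ℂ) ^ (-w)) - (p:ℂ) ^ (-w))

lemma norm_prime_cpow (p : Nat.Primes) (w : ℂ) : ‖((p:ℕ):ℂ) ^ (-w)‖ = ((p:ℕ):ℝ) ^ (-w.re) := by
  have hp : (0:ℝ) < ((p:ℕ):ℝ) := by exact_mod_cast p.2.pos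
  have := Complex.norm_cpow_eq_rpow_re_of_pos hp (-w)
  simpa using this

lemma prime_rpow_le (p : Nat.Primes) {σ x : ℝ} (h : σ ≤ x) : ((p:ℕ):ℝ) ^ (-x) ≤ ((p:ℕ):ℝ) ^ (-σ) := by
  apply Real.rpow_le_rpow_of_exponent_le
  · exact_mod_cast p.2.one_lt.le
  · linarith

lemma prime_rpow_le_two (p : Nat.Primes) {σ : ℝ} (h : 0 < σ) : ((p:ℕ):ℝ) ^ (-σ) ≤ (2:ℝ) ^ (-σ) := by
  apply Real.rpow_le_rpow_of_nonpos (by norm_num)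
  · exact_mod_cast p.2.two_le
  · linarith

lemma R_term_bound (p : Nat.Primes) {σ : ℝ} (h : 0 < σ) {w : ℂ} (hw : σ ≤ w.re) :
    ‖-Complex.log (1 - ((p:ℕ):ℂ) ^ (-w)) - ((p:ℕ):ℂ) ^ (-w)‖ ≤
      (1 - (2:ℝ) ^ (-σ))⁻¹ / 2 * ((p:ℕ):ℝ) ^ (-(2 * σ)) := by
  set z := ((p:ℕ):ℂ) ^ (-w) with hz
  have hzn : ‖z‖ ≤ ((p:ℕ):ℝ) ^ (-σ) := by rw [hz, norm_prime_cpow]; exact prime_rpow_le p hw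
  have h2 : (2:ℝ) ^ (-σ) < 1 := Real.rpow_lt_one_of_one_lt_of_neg (by norm_num) (by linarith)
  have hz2 : ‖z‖ ≤ (2:ℝ) ^ (-σ) := hzn.trans (prime_rpow_le_two p h)
  have hz1 : ‖-z‖ < 1 := by rw [norm_neg]; linarith
  have hb := Complex.norm_log_one_add_sub_self_le hz1
  have e : ‖-Complex.log (1 - z) - z‖ = ‖Complex.log (1 + -z) - -z‖ := by
    rw [← norm_neg]; congr 1; ring_nf
  rw [e]
  refine hb.trans ?_
  rw [norm_neg]
  have hp : (0:ℝ) < ((p:ℕ):ℝ) := by exact_mod_cast p.2.pos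
  have e2 : ((p:ℕ):ℝ) ^ (-(2 * σ)) = (((p:ℕ):ℝ) ^ (-σ)) ^ 2 := by
    rw [← Real.rpow_natCast, ← Real.rpow_mul hp.le]; congr 1; push_cast; ring
  rw [e2]
  have h3 : 0 < 1 - (2:ℝ) ^ (-σ) := by linarith
  have : (1 - ‖z‖)⁻¹ ≤ (1 - (2:ℝ) ^ (-σ))⁻¹ := by
    apply inv_anti₀ h3; linarith
  have h4 : 0 ≤ (1 - ‖z‖)⁻¹ := inv_nonneg.mpr (by linarith)
  calc ‖z‖ ^ 2 * (1 - ‖z‖)⁻¹ / 2 ≤ (((p:ℕ):ℝ) ^ (-σ)) ^ 2 * (1 - (2:ℝ) ^ (-σ))⁻¹ / 2 := by gcongr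
    _ = _ := by ring

lemma R_bound_summable {σ : ℝ} (h : 1 / 2 < σ) :
    Summable (fun p : Nat.Primes => (1 - (2:ℝ) ^ (-σ))⁻¹ / 2 * ((p:ℕ):ℝ) ^ (-(2 * σ))) := by
  apply Summable.mul_left
  exact Nat.Primes.summable_rpow.mpr (by linarith)

lemma R_diff : DifferentiableOn ℂ Rfun {w : ℂ | 1 / 2 < w.re} := by
  intro w (hw : 1 / 2 < w.re)
  obtain ⟨σ, h1, h2⟩ := exists_between hw
  have hd : DifferentiableOn ℂ Rfun {w : ℂ | σ < w.re} := by
    refine Complex.differentiableOn_tsum_of_summable_norm (R_bound_summable h1) ?_ (isOpen_re_gt σ) ?_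
    · intro p s (hs : σ < s.re)
      have hp : ((p:ℕ):ℂ) ≠ 0 := by exact_mod_cast p.2.ne_zero
      have hslit : 1 - ((p:ℕ):ℂ) ^ (-s) ∈ Complex.slitPlane := by
        have : ‖-((p:ℕ):ℂ) ^ (-s)‖ < 1 := by
          rw [norm_neg, norm_prime_cpow]
          exact Real.rpow_lt_one_of_one_lt_of_neg (by exact_mod_cast p.2.one_lt) (by linarith)
        simpa [sub_eq_add_neg] using Complex.mem_slitPlane_of_norm_lt_one this
      have hc : DifferentiableAt ℂ (fun s : ℂ => ((p:ℕ):ℂ) ^ (-s)) s :=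
        DifferentiableAt.const_cpow (by fun_prop) (Or.inl hp)
      exact ((((hc.const_sub 1).clog hslit).neg).sub hc).differentiableWithinAt
    · intro p s (hs : σ < s.re)
      exact R_term_bound p (by linarith) hs.le
  exact (hd.differentiableAt ((isOpen_re_gt σ).mem_nhds h2)).differentiableWithinAt

/-- prime zeta function -/
noncomputable def Pfun (w : ℂ) : ℂ := ∑' p : Nat.Primes, ((p:ℕ):ℂ) ^ (-w)

lemma P_summable {w : ℂ} (hw : 1 < w.re) : Summable (fun p : Nat.Primes => ((p:ℕ):ℂ) ^ (-w)) := by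
  apply Summable.of_norm
  simp_rw [norm_prime_cpow]
  exact Nat.Primes.summable_rpow.mpr (by linarith)

lemma exp_P_R {w : ℂ} (hw : 1 < w.re) : Complex.exp (Pfun w + Rfun w) = riemannZeta w := by
  rw [← riemannZeta_eulerProduct_exp_log hw]
  congr 1
  have hR : Summable (fun p : Nat.Primes => (-Complex.log (1 - ((p:ℕ):ℂ) ^ (-w)) - ((p:ℕ):ℂ) ^ (-w))) :=
    Summable.of_norm_bounded (R_bound_summable (σ := w.re) (by linarith))
      (fun p => R_term_bound p (by linarith) le_rfl)
  unfold Pfun Rfun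
  rw [← (P_summable hw).tsum_add hR]
  congr 1; ext p; ring

lemma primeCounting_le (n : ℕ) : Nat.primeCounting n ≤ n := by
  rw [Nat.primeCounting, Nat.primeCounting', Nat.count_eq_card_filter_range]
  calc _ ≤ (Finset.Icc 1 n).card := by
        apply Finset.card_le_card
        intro k
        simp only [Finset.mem_filter, Finset.mem_Icc, Finset.mem_range]
        rintro ⟨h, hp⟩; exact ⟨hp.one_lt.le, by omega⟩
    _ = n := by simp

lemma P_integral {w : ℂ} (hw : 1 < w.re) :
    Pfun w = w * ∫ t in Set.Ioi (1:ℝ), (primePi t : ℂ) * (t:ℂ) ^ (-w - 1) := by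
  set f : ℕ → ℝ := fun n => if n.Prime then 1 else 0 with hf
  have hsum : ∀ n : ℕ, ∑ k ∈ Finset.Icc 1 n, f k = (Nat.primeCounting n : ℝ) := by
    intro n
    simp only [hf]
    rw [Finset.sum_boole, Nat.primeCounting, Nat.primeCounting', Nat.count_eq_card_filter_range]
    congr 2
    ext k; simp only [Finset.mem_filter, Finset.mem_Icc, Finset.mem_range]
    constructor
    · rintro ⟨⟨_, h⟩, hp⟩; exact ⟨by omega, hp⟩
    · rintro ⟨h, hp⟩; exact ⟨⟨hp.one_lt.le, by omega⟩, hp⟩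
  have h1 := LSeries_eq_mul_integral_of_nonneg f (r := 1) zero_le_one (s := w) hw
    (by
      simp_rw [hsum]
      refine Asymptotics.isBigO_of_le _ (fun n => ?_)
      simp only [Real.norm_natCast, Real.rpow_one]
      exact_mod_cast primeCounting_le n) (fun n => by simp only [hf]; positivity)
  have h2 : LSeries (fun n => (f n : ℂ)) w = Pfun w := by
    unfold LSeries Pfun
    have : (fun n => LSeries.term (fun n => (f n : ℂ)) w n) =
        Set.indicator {p : ℕ | p.Prime} (fun n : ℕ => (n:ℂ) ^ (-w)) := by
      ext n
      by_cases hn : n.Prime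
      · rw [LSeries.term_of_ne_zero hn.ne_zero]
        simp [hf, hn, Complex.cpow_neg]
      · by_cases h0 : n = 0
        · simp [h0, LSeries.term_zero, Nat.not_prime_zero]
        · rw [LSeries.term_of_ne_zero h0]
          simp [hf, hn]
    rw [this]
    exact (tsum_subtype {p : ℕ | p.Prime} (fun n : ℕ => (n:ℂ) ^ (-w))).symm
  rw [← h2, h1]
  congr 1
  refine setIntegral_congr_fun measurableSet_Ioi ?_
  intro t _
  dsimp only
  rw [← Complex.ofReal_sum, hsum, primePi, neg_add, ← sub_eq_add_neg]

lemma integral_Ioi_one_eq_two {h g : ℝ → ℂ} (h0 : ∀ t, 1 < t → t < 2 → h t = 0)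
    (hg : ∀ t, 2 < t → h t = g t) :
    ∫ t in Set.Ioi (1:ℝ), h t = ∫ t in Set.Ioi (2:ℝ), g t := by
  have h1 : ∫ t in Set.Ioi (1:ℝ), h t = ∫ t in Set.Ici (2:ℝ), h t := by
    apply setIntegral_eq_of_subset_of_forall_sdiff_eq_zero measurableSet_Ioi
    · intro t (ht : 2 ≤ t); exact lt_of_lt_of_le one_lt_two ht
    · rintro t ⟨ht, ht2⟩
      exact h0 t ht (not_le.mp ht2)
  rw [h1, integral_Ici_eq_integral_Ioi]
  exact setIntegral_congr_fun measurableSet_Ioi (fun t ht => hg t ht)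

/-- weight for the Mellin transform of `1 / log` -/
noncomputable def Gm (t : ℝ) : ℝ := if 2 < t then t / Real.log t else 0

lemma Gm_meas : Measurable Gm := by
  unfold Gm
  refine Measurable.ite measurableSet_Ioi (by fun_prop) (by fun_prop)

lemma Gm_nonneg (t : ℝ) : 0 ≤ Gm t := by
  unfold Gm
  split_ifs with h
  · have := Real.log_pos (by linarith : 1 < t)
    positivity
  · exact le_rfl

lemma Gm_conv {σ : ℝ} (h : 1 < σ) : Conv Gm σ := by
  refine conv_of_bound (C := (Real.log 2)⁻¹) (k := 1) Gm_meas ?_ h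
  intro t ht
  rw [abs_of_nonneg (Gm_nonneg t), Real.rpow_one]
  have hl := Real.log_pos one_lt_two
  unfold Gm
  split_ifs with h2
  · rw [div_eq_inv_mul]
    gcongr
  · positivity

lemma M_hasDeriv {w : ℂ} (hw : 1 < w.re) :
    HasDerivAt (Phi Gm) (-((2:ℂ) ^ (1 - w) / (w - 1))) w := by
  obtain ⟨σ, h1, h2⟩ := exists_between hw
  have h := (Phi_hasFPower Gm_meas Gm_nonneg (Gm_conv h1) h2).hasDerivAt
  convert! h using 1
  rw [FormalMultilinearSeries.ofScalars_apply_eq]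
  simp only [one_pow, smul_eq_mul, mul_one]
  unfold PhiCoef
  rw [integral_Ioi_one_eq_two (g := fun t : ℝ => -(t:ℂ) ^ (-w))]
  · rw [integral_neg, integral_Ioi_cpow_of_lt (by simpa using hw) two_pos]
    have hne : w - 1 ≠ 0 := by
      intro h; have : w = 1 := sub_eq_zero.mp h
      rw [this] at hw; simp at hw
    have : -w + 1 ≠ 0 := by intro h; apply hne; linear_combination -h
    push_cast
    rw [show -w + 1 = -(w - 1) by ring, show (1 : ℂ) - w = -(w - 1) by ring]
    field_simp
  · intro t ht ht2
    simp [Gm, ht2.le.not_gt]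
  · intro t ht
    have hl : Real.log t ≠ 0 := (Real.log_pos (by linarith)).ne'
    have hl' : (Real.log t : ℂ) ≠ 0 := by exact_mod_cast hl
    have ht0 : (t:ℂ) ≠ 0 := by exact_mod_cast (by linarith : t ≠ 0)
    simp only [Gm, ht, if_true, pow_one, Nat.factorial_one, Nat.cast_one, div_one]
    rw [Complex.cpow_sub _ _ ht0, Complex.cpow_one]
    push_cast
    field_simp

lemma exists_E : ∃ E : ℂ → ℂ, ∀ w, HasDerivAt E (dslope (fun w : ℂ => (2:ℂ) ^ (1 - w)) 1 w) w := by
  have hd : Differentiable ℂ (fun w : ℂ => (2:ℂ) ^ (1 - w)) := by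
    intro w
    exact DifferentiableAt.const_cpow (by fun_prop) (Or.inl two_ne_zero)
  have hs : Differentiable ℂ (dslope (fun w : ℂ => (2:ℂ) ^ (1 - w)) 1) := by
    rw [← differentiableOn_univ] at hd ⊢
    exact (Complex.differentiableOn_dslope Filter.univ_mem).mpr hd
  obtain ⟨E, hE⟩ := hs.isExactOn_univ
  exact ⟨E, fun w => hE w (Set.mem_univ _)⟩

lemma exists_M_formula : ∃ E : ℂ → ℂ, ∃ C : ℂ, C ≠ 0 ∧ Differentiable ℂ E ∧
    ∀ w : ℂ, 1 < w.re → Complex.exp (-Phi Gm w) = C * (w - 1) * Complex.exp (E w) := by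
  obtain ⟨E, hE⟩ := exists_E
  set N : ℂ → ℂ := fun w => Complex.exp (Phi Gm w) * ((w - 1) * Complex.exp (E w)) with hN
  have hNd : ∀ w : ℂ, 1 < w.re → HasDerivAt N 0 w := by
    intro w hw
    have h := (M_hasDeriv hw).cexp.mul (((hasDerivAt_id w).sub_const 1).mul (hE w).cexp)
    convert! h using 1
    have hne : w - 1 ≠ 0 := by
      intro h; have : w = 1 := sub_eq_zero.mp h
      rw [this] at hw; simp at hw
    rw [dslope_of_ne _ (sub_ne_zero.mp hne), slope_def_field]
    simp only [id, sub_self, Complex.cpow_zero, Pi.mul_apply]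
    field_simp
    ring
  have hconst : ∀ w : ℂ, 1 < w.re → N w = N 2 := by
    intro w hw
    refine (isOpen_re_gt 1).is_const_of_deriv_eq_zero (isPreconnected_re_gt 1) ?_ ?_ hw (by simp)
    · intro z hz; exact (hNd z hz).differentiableAt.differentiableWithinAt
    · intro z hz; exact (hNd z hz).deriv
  have hN2 : N 2 ≠ 0 := by
    simp only [hN]
    refine mul_ne_zero (Complex.exp_ne_zero _) (mul_ne_zero (by norm_num) (Complex.exp_ne_zero _))
  refine ⟨E, (N 2)⁻¹, inv_ne_zero hN2, fun w => (hE w).differentiableAt, fun w hw => ?_⟩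
  rw [← hconst w hw]
  have hne : w - 1 ≠ 0 := by
    intro h; have : w = 1 := sub_eq_zero.mp h
    rw [this] at hw; simp at hw
  simp only [hN]
  rw [Complex.exp_neg]
  have := Complex.exp_ne_zero (E w)
  have := Complex.exp_ne_zero (Phi Gm w)
  field_simp

lemma primePi_mono : Monotone primePi := by
  intro a b h
  unfold primePi
  exact_mod_cast Nat.monotone_primeCounting (Nat.floor_mono h)

lemma primePi_abs_le {t : ℝ} (ht : 0 ≤ t) : |primePi t| ≤ t := by
  unfold primePi
  rw [abs_of_nonneg (Nat.cast_nonneg _)]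
  calc ((Nat.primeCounting ⌊t⌋₊ : ℕ) : ℝ) ≤ (⌊t⌋₊ : ℝ) := by exact_mod_cast primeCounting_le _
    _ ≤ t := Nat.floor_le ht

lemma primePi_zero {t : ℝ} (ht : t < 2) : primePi t = 0 := by
  unfold primePi
  have : ⌊t⌋₊ < 2 := by
    rw [Nat.floor_lt' (by norm_num)]; exact_mod_cast ht
  have h0 : Nat.primeCounting ⌊t⌋₊ = 0 := by
    interval_cases ⌊t⌋₊
    · exact Nat.primeCounting_zero
    · exact Nat.primeCounting_one
  rw [h0]; simp

/-- truncated `1 / log` -/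
noncomputable def Lg (u : ℝ) : ℝ := 1 / Real.log (max 2 u)

lemma Lg_log_pos (u : ℝ) : Real.log 2 ≤ Real.log (max 2 u) :=
  Real.log_le_log two_pos (le_max_left _ _)

lemma Lg_cont : Continuous Lg := by
  unfold Lg
  have h := Real.log_pos one_lt_two
  refine Continuous.div continuous_const ?_ (fun u => by have := Lg_log_pos u; linarith)
  refine Continuous.log (by fun_prop) (fun u => ?_)
  have := le_max_left (2:ℝ) u
  linarith

lemma Lg_abs_le (u : ℝ) : |Lg u| ≤ (Real.log 2)⁻¹ := by
  have h := Real.log_pos one_lt_two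
  have h2 := Lg_log_pos u
  unfold Lg
  rw [abs_of_nonneg (by have : 0 < Real.log (max 2 u) := by linarith
                        positivity), one_div]
  exact inv_anti₀ h h2

/-- continuous version of `li` -/
noncomputable def Lq (t : ℝ) : ℝ := li 2 + ∫ u in (2:ℝ)..t, Lg u

lemma prim_Lg_cont : Continuous (fun t => ∫ u in (2:ℝ)..t, Lg u) :=
  intervalIntegral.continuous_primitive (fun _ _ => Lg_cont.intervalIntegrable _ _) 2

lemma Lq_cont : Continuous Lq := continuous_const.add prim_Lg_cont

lemma Lq_eq {t : ℝ} (ht : 2 ≤ t) : li t = Lq t := by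
  rw [li_eq_add ht, Lq]
  congr 1
  refine intervalIntegral.integral_congr ?_
  intro u hu
  rw [Set.uIcc_of_le ht] at hu
  simp [Lg, max_eq_right hu.1]

lemma prim_Lg_abs_le {t : ℝ} (ht : 2 < t) : |∫ u in (2:ℝ)..t, Lg u| ≤ (Real.log 2)⁻¹ * t := by
  have h := intervalIntegral.norm_integral_le_of_norm_le_const (a := 2) (b := t)
    (f := Lg) (C := (Real.log 2)⁻¹) (fun u _ => Lg_abs_le u)
  rw [Real.norm_eq_abs] at h
  refine h.trans ?_
  have := inv_pos.mpr (Real.log_pos one_lt_two)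
  rw [abs_of_pos (by linarith)]
  gcongr
  linarith

lemma pi_Lq_abs_le {t : ℝ} (ht : 2 < t) :
    |primePi t - Lq t| ≤ (1 + |li 2| + (Real.log 2)⁻¹) * t := by
  have h1 := primePi_abs_le (by linarith : 0 ≤ t)
  have h2 := prim_Lg_abs_le ht
  have h3 : |Lq t| ≤ |li 2| + |∫ u in (2:ℝ)..t, Lg u| := abs_add_le _ _
  have h4 : |li 2| ≤ |li 2| * t := by
    have := abs_nonneg (li 2)
    nlinarith
  calc |primePi t - Lq t| ≤ |primePi t| + |Lq t| := abs_sub _ _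
    _ ≤ _ := by nlinarith

lemma integrable_lin {g : ℝ → ℝ} (hg : Measurable g) {C : ℝ} (hb : ∀ t, 2 < t → |g t| ≤ C * t)
    {w : ℂ} (hw : 1 < w.re) :
    IntegrableOn (fun t : ℝ => (g t : ℂ) * (t:ℂ) ^ (-w - 1)) (Set.Ioi 2) := by
  have h1 : IntegrableOn (fun t : ℝ => C * t ^ (-w.re)) (Set.Ioi 2) :=
    (integrableOn_Ioi_rpow_of_lt (by linarith) two_pos).const_mul _
  refine Integrable.mono' h1 (Measurable.aestronglyMeasurable (by fun_prop)) ?_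
  filter_upwards [ae_restrict_mem measurableSet_Ioi] with t (ht : 2 < t)
  rw [norm_mul, Complex.norm_cpow_eq_rpow_re_of_pos (by linarith), Complex.norm_real, Real.norm_eq_abs]
  have e : t ^ (-w.re) = t * t ^ (-w.re - 1) := by
    rw [Real.rpow_sub_one (by linarith)]; field_simp
  have e2 : (-w - 1).re = -w.re - 1 := by simp
  rw [e, e2, ← mul_assoc]
  gcongr
  exact hb t ht

lemma Lq_transform {w : ℂ} (hw : 1 < w.re) :
    w * ∫ t in Set.Ioi (2:ℝ), (Lq t : ℂ) * (t:ℂ) ^ (-w - 1) =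
      (li 2 : ℂ) * (2:ℂ) ^ (-w) + Phi Gm w := by
  have hw0 : w ≠ 0 := by rintro rfl; simp at hw; linarith
  have h1 := fubini_aux Lg Lg_cont.measurable ((Real.log 2)⁻¹) 0
    (fun t _ => by simpa using Lg_abs_le t) w (by linarith) (by linarith)
  have h2 : Phi Gm w = ∫ t in Set.Ioi (2:ℝ), (Lg t : ℂ) * (t:ℂ) ^ (-w) := by
    unfold Phi
    refine integral_Ioi_one_eq_two ?_ ?_
    · intro t ht ht2
      simp [Gm, ht2.le.not_gt]
    · intro t ht
      have ht0 : (t:ℂ) ≠ 0 := by exact_mod_cast (by linarith : t ≠ 0)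
      simp only [Gm, Lg, ht, if_true, max_eq_right ht.le]
      rw [Complex.cpow_sub _ _ ht0, Complex.cpow_one]
      push_cast
      field_simp
  have hi1 := integrable_lin (g := fun _ => li 2) measurable_const (C := |li 2|)
    (fun t ht => by have := abs_nonneg (li 2); nlinarith) hw
  have hi2 := integrable_lin prim_Lg_cont.measurable (fun t ht => prim_Lg_abs_le ht) hw
  have h3 : ∫ t in Set.Ioi (2:ℝ), (Lq t : ℂ) * (t:ℂ) ^ (-w - 1) =
      (∫ t in Set.Ioi (2:ℝ), (li 2 : ℂ) * (t:ℂ) ^ (-w - 1)) +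
      ∫ t in Set.Ioi (2:ℝ), ((∫ u in (2:ℝ)..t, Lg u : ℝ) : ℂ) * (t:ℂ) ^ (-w - 1) := by
    rw [← integral_add hi1 hi2]
    congr 1; ext t
    rw [Lq]; push_cast; ring
  rw [h3, h1, ← h2, integral_const_mul, integral_Ioi_cpow_of_lt (by simp; linarith) two_pos]
  have e : -w - 1 + 1 = -w := by ring
  rw [e]
  push_cast
  field_simp

lemma pi_Lq_transform {w : ℂ} (hw : 1 < w.re) :
    w * ∫ t in Set.Ioi (2:ℝ), ((primePi t - Lq t : ℝ) : ℂ) * (t:ℂ) ^ (-w - 1) =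
      Pfun w - (li 2 : ℂ) * (2:ℂ) ^ (-w) - Phi Gm w := by
  have hi1 := integrable_lin primePi_mono.measurable (C := 1)
    (fun t ht => by simpa using primePi_abs_le (by linarith : 0 ≤ t)) hw
  have hi2 := integrable_lin Lq_cont.measurable (C := |li 2| + (Real.log 2)⁻¹) (fun t ht => by
    have h2 := prim_Lg_abs_le ht
    have h3 : |Lq t| ≤ |li 2| + |∫ u in (2:ℝ)..t, Lg u| := abs_add_le _ _
    have := abs_nonneg (li 2)
    nlinarith) hw
  have h3 : ∫ t in Set.Ioi (2:ℝ), ((primePi t - Lq t : ℝ) : ℂ) * (t:ℂ) ^ (-w - 1) =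
      (∫ t in Set.Ioi (2:ℝ), (primePi t : ℂ) * (t:ℂ) ^ (-w - 1)) -
      ∫ t in Set.Ioi (2:ℝ), (Lq t : ℂ) * (t:ℂ) ^ (-w - 1) := by
    rw [← integral_sub hi1 hi2]
    congr 1; ext t
    push_cast; ring
  have h4 : Pfun w = w * ∫ t in Set.Ioi (2:ℝ), (primePi t : ℂ) * (t:ℂ) ^ (-w - 1) := by
    rw [P_integral hw]
    congr 1
    refine integral_Ioi_one_eq_two ?_ (fun t _ => rfl)
    intro t _ ht
    rw [primePi_zero ht]; simp
  rw [h3, mul_sub, ← h4, Lq_transform hw]; ring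

/-- the integrand, regularised to the left of `2` -/
noncomputable def fI (c t : ℝ) : ℝ := (primePi t - Lq t) * (max 2 t) ^ (-c)

lemma max_rpow_cont (c : ℝ) : Continuous (fun t : ℝ => (max 2 t) ^ (-c)) := by
  refine Continuous.rpow_const (by fun_prop) (fun t => Or.inl ?_)
  have := le_max_left (2:ℝ) t
  linarith

lemma fI_meas (c : ℝ) : Measurable (fI c) :=
  (primePi_mono.measurable.sub Lq_cont.measurable).mul (max_rpow_cont c).measurable

lemma fI_int (c a b : ℝ) : IntervalIntegrable (fI c) volume a b :=
  IntervalIntegrable.mul_continuousOn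
    ((primePi_mono.intervalIntegrable).sub (Lq_cont.intervalIntegrable _ _))
    (max_rpow_cont c).continuousOn

/-- the constant in the bound for `fI` -/
noncomputable def CI : ℝ := 1 + |li 2| + (Real.log 2)⁻¹

lemma CI_nonneg : 0 ≤ CI := by
  have := Real.log_pos one_lt_two
  unfold CI; positivity

lemma fI_abs_le (c : ℝ) {t : ℝ} (ht : 2 < t) : |fI c t| ≤ CI * t ^ (1 - c) := by
  unfold fI
  rw [abs_mul, max_eq_right ht.le, abs_of_nonneg (by positivity : 0 ≤ t ^ (-c)),
    sub_eq_add_neg 1 c, Real.rpow_add (by linarith), Real.rpow_one, ← mul_assoc]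
  gcongr
  exact pi_Lq_abs_le ht

/-- the primitive -/
noncomputable def FI (c x : ℝ) : ℝ := ∫ t in (2:ℝ)..x, fI c t

lemma FI_cont (c : ℝ) : Continuous (FI c) :=
  intervalIntegral.continuous_primitive (fun a b => fI_int c a b) 2

lemma FI_eq (c : ℝ) {x : ℝ} (hx : 2 ≤ x) :
    (∫ t in (2:ℝ)..x, (primePi t - li t) / t ^ c) = FI c x := by
  refine intervalIntegral.integral_congr ?_
  intro t ht
  rw [Set.uIcc_of_le hx] at ht
  simp only [fI, max_eq_right ht.1, Lq_eq ht.1]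
  rw [Real.rpow_neg (by linarith [ht.1]), div_eq_mul_inv]

lemma FI_abs_le {c : ℝ} (hc : c < 2) {x : ℝ} (hx : 2 < x) :
    |FI c x| ≤ CI / (2 - c) * x ^ (2 - c) := by
  have h1 : |FI c x| ≤ ∫ t in (2:ℝ)..x, CI * t ^ (1 - c) := by
    rw [← Real.norm_eq_abs, FI]
    refine intervalIntegral.norm_integral_le_of_norm_le (f := fI c) hx.le ?_ ?_
    · exact Filter.Eventually.of_forall (fun t ht => fI_abs_le c ht.1)
    · exact (intervalIntegral.intervalIntegrable_rpow' (by linarith)).const_mul _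
  refine h1.trans ?_
  rw [intervalIntegral.integral_const_mul, integral_rpow (Or.inl (by linarith)),
    show 1 - c + 1 = 2 - c by ring, div_mul_eq_mul_div, mul_div_assoc]
  have : 0 ≤ (2:ℝ) ^ (2 - c) := by positivity
  have h0 := CI_nonneg
  have : 0 < 2 - c := by linarith
  gcongr
  linarith

lemma FI_transform {c : ℝ} (hc : c < 2) {s : ℂ} (hs : 2 - c < s.re) :
    (s + c - 1) * s * ∫ x in Set.Ioi (2:ℝ), (FI c x : ℂ) * (x:ℂ) ^ (-s - 1) =
      Pfun (s + c - 1) - (li 2 : ℂ) * (2:ℂ) ^ (-(s + c - 1)) - Phi Gm (s + c - 1) := by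
  have hs0 : 0 < s.re := by linarith
  have hsne : s ≠ 0 := by rintro rfl; simp at hs0
  have hw : 1 < (s + c - 1).re := by simp; linarith
  rw [← pi_Lq_transform hw]
  have h1 := fubini_aux (fI c) (fI_meas c) CI (1 - c) (fun t ht => fI_abs_le c ht) s hs0 (by linarith)
  unfold FI
  rw [h1, mul_assoc, mul_div_cancel₀ _ hsne]
  congr 1
  refine setIntegral_congr_fun measurableSet_Ioi ?_
  intro t (ht : 2 < t)
  have ht0 : (t:ℂ) ≠ 0 := by exact_mod_cast (by linarith : t ≠ 0)
  simp only [fI, max_eq_right ht.le]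
  rw [show -(s + c - 1) - 1 = -(c:ℂ) + -s by ring, Complex.cpow_add _ _ ht0, Complex.ofReal_mul,
    Complex.ofReal_cpow (by linarith)]
  push_cast; ring

lemma no_zero_of_nonpos {c : ℝ} (hc : c < 2) {X0 : ℝ} (hX0 : 2 ≤ X0)
    (hneg : ∀ x, X0 < x → FI c x ≤ 0) :
    ∀ ρ : ℂ, max (1 / 2) (c - 1) < ρ.re → riemannZeta₁ ρ ≠ 0 := by
  obtain ⟨E, C0, hC0, hE, hM⟩ := exists_M_formula
  set s0 : ℝ := max (1 / 2) (c - 1) - c + 1 with hs0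
  have hs0nn : 0 ≤ s0 := by
    have := le_max_right (1 / 2 : ℝ) (c - 1); linarith
  have hs0h : 1 / 2 ≤ s0 + c - 1 := by
    have := le_max_left (1 / 2 : ℝ) (c - 1); linarith
  have hFm : Measurable (FI c) := (FI_cont c).measurable
  set G : ℝ → ℝ := fun t => if X0 < t then -FI c t else 0 with hG
  set G1 : ℝ → ℝ := fun t => if 2 < t ∧ t ≤ X0 then max (FI c t) 0 else 0 with hG1
  set G2 : ℝ → ℝ := fun t => if 2 < t ∧ t ≤ X0 then max (-FI c t) 0 else 0 with hG2
  have hGm : Measurable G := Measurable.ite measurableSet_Ioi (by fun_prop) (by fun_prop)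
  have hG1m : Measurable G1 :=
    Measurable.ite (measurableSet_Ioc (a := (2:ℝ)) (b := X0)) (by fun_prop) (by fun_prop)
  have hG2m : Measurable G2 :=
    Measurable.ite (measurableSet_Ioc (a := (2:ℝ)) (b := X0)) (by fun_prop) (by fun_prop)
  have hG0 : ∀ t, 0 ≤ G t := by
    intro t; simp only [hG]; split_ifs with h
    · have := hneg t h; linarith
    · exact le_rfl
  have hG10 : ∀ t, 0 ≤ G1 t := by
    intro t; simp only [hG1]; split_ifs <;> simp
  have hG20 : ∀ t, 0 ≤ G2 t := by
    intro t; simp only [hG2]; split_ifs <;> simp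
  have h2c : 0 < 2 - c := by linarith
  have hCI := CI_nonneg
  have hconv : ∀ σ, 2 - c < σ → Conv G σ := by
    intro σ hσ
    refine conv_of_bound (C := CI / (2 - c)) (k := 2 - c) hGm ?_ hσ
    intro t ht
    simp only [hG]; split_ifs with h
    · rw [abs_neg]; exact FI_abs_le hc (by linarith)
    · rw [abs_zero]; positivity
  have hbd : ∀ t, 2 < t → t ≤ X0 → |FI c t| ≤ CI / (2 - c) * X0 ^ (2 - c) := by
    intro t h1 h2
    refine (FI_abs_le hc h1).trans ?_
    gcongr
  have hX0p : 0 ≤ CI / (2 - c) * X0 ^ (2 - c) := by positivity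
  have hconv1 : ∀ σ, 0 < σ → Conv G1 σ := by
    intro σ hσ
    refine conv_of_bound (C := CI / (2 - c) * X0 ^ (2 - c)) (k := 0) hG1m ?_ hσ
    intro t ht
    rw [abs_of_nonneg (hG10 t), Real.rpow_zero, mul_one]
    simp only [hG1]; split_ifs with h
    · exact max_le ((le_abs_self _).trans (hbd t h.1 h.2)) hX0p
    · exact hX0p
  have hconv2 : ∀ σ, 0 < σ → Conv G2 σ := by
    intro σ hσ
    refine conv_of_bound (C := CI / (2 - c) * X0 ^ (2 - c)) (k := 0) hG2m ?_ hσ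
    intro t ht
    rw [abs_of_nonneg (hG20 t), Real.rpow_zero, mul_one]
    simp only [hG2]; split_ifs with h
    · exact max_le ((neg_le_abs _).trans (hbd t h.1 h.2)) hX0p
    · exact hX0p
  have hd1 : DifferentiableOn ℂ (Phi G1) {s : ℂ | s0 < s.re} := by
    intro s (hs : s0 < s.re)
    obtain ⟨σ, h1, h2⟩ := exists_between hs
    exact (Phi_differentiableAt hG1m hG10 (hconv1 σ (by linarith)) h2).differentiableWithinAt
  have hd2 : DifferentiableOn ℂ (Phi G2) {s : ℂ | s0 < s.re} := by
    intro s (hs : s0 < s.re)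
    obtain ⟨σ, h1, h2⟩ := exists_between hs
    exact (Phi_differentiableAt hG2m hG20 (hconv2 σ (by linarith)) h2).differentiableWithinAt
  have hF : ∀ s : ℂ, 2 - c < s.re →
      ∫ x in Set.Ioi (2:ℝ), (FI c x : ℂ) * (x:ℂ) ^ (-s - 1) = Phi G1 s - Phi G2 s - Phi G s := by
    intro s hs
    have i1 := Phi_integrable hG1m (s := s) (hconv1 _ (by linarith))
    have i2 := Phi_integrable hG2m (s := s) (hconv2 _ (by linarith))
    have i3 := Phi_integrable hGm (s := s) (hconv _ hs)
    unfold Phi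
    have i12 : IntegrableOn (fun t : ℝ => (G1 t : ℂ) * (t:ℂ) ^ (-s - 1) - (G2 t : ℂ) * (t:ℂ) ^ (-s - 1))
        (Set.Ioi 1) := i1.sub i2
    rw [← integral_sub i1 i2, ← integral_sub i12 i3]
    symm
    refine integral_Ioi_one_eq_two ?_ ?_
    · intro t _ ht
      have a1 : ¬ (2 < t ∧ t ≤ X0) := fun h => by linarith [h.1]
      have a2 : ¬ (X0 < t) := by linarith
      simp only [hG, hG1, hG2, a1, a2, if_false]
      simp
    · intro t ht
      rw [← sub_mul, ← sub_mul]
      congr 1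
      rw [← Complex.ofReal_sub, ← Complex.ofReal_sub]
      congr 1
      by_cases h : t ≤ X0
      · have a1 : (2 < t ∧ t ≤ X0) := ⟨ht, h⟩
        have a2 : ¬ (X0 < t) := by linarith
        simp only [hG, hG1, hG2, a1, a2, if_false, and_self, if_true, sub_zero]
        rcases le_total 0 (FI c t) with h | h
        · rw [max_eq_left h, max_eq_right (by linarith)]; ring
        · rw [max_eq_right h, max_eq_left (by linarith)]; ring
      · have a1 : ¬ (2 < t ∧ t ≤ X0) := fun h' => h h'.2
        have a2 : X0 < t := by linarith
        simp only [hG, hG1, hG2, a1, a2, if_false, if_true]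
        ring
  have key := landau_exp hGm hG0 s0 (2 - c) hconv
    (fun s => (s + c - 1) * s * (Phi G1 s - Phi G2 s))
    (fun s => -((s + c - 1) * s))
    (fun s => C0 * riemannZeta₁ (s + c - 1) *
      Complex.exp (-Rfun (s + c - 1) - (li 2 : ℂ) * (2:ℂ) ^ (-(s + c - 1)) + E (s + c - 1)))
    (by
      have : DifferentiableOn ℂ (fun s : ℂ => (s + c - 1) * s) {s : ℂ | s0 < s.re} := by fun_prop
      exact this.mul (hd1.sub hd2))
    (by fun_prop)
    (by
      have ha : DifferentiableOn ℂ (fun s : ℂ => s + c - 1) {s : ℂ | s0 < s.re} := by fun_prop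
      have hz : DifferentiableOn ℂ (fun s : ℂ => riemannZeta₁ (s + c - 1)) {s : ℂ | s0 < s.re} :=
        differentiable_riemannZeta₁.comp_differentiableOn ha
      have he : DifferentiableOn ℂ (fun s : ℂ => E (s + c - 1)) {s : ℂ | s0 < s.re} :=
        hE.comp_differentiableOn ha
      have hr : DifferentiableOn ℂ (fun s : ℂ => Rfun (s + c - 1)) {s : ℂ | s0 < s.re} := by
        refine R_diff.comp ha ?_
        intro s (hs : s0 < s.re)
        show 1 / 2 < (s + c - 1).re
        simp; linarith
      have ht : DifferentiableOn ℂ (fun s : ℂ => (2:ℂ) ^ (-(s + c - 1))) {s : ℂ | s0 < s.re} := by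
        intro s _
        exact (DifferentiableAt.const_cpow (by fun_prop) (Or.inl two_ne_zero)).differentiableWithinAt
      exact (hz.const_mul C0).mul (((hr.neg.sub (ht.const_mul _)).add he).cexp))
    (by
      intro s hs
      have h1 : s ≠ 0 := by rintro rfl; simp at hs; linarith
      have h2 : s + c - 1 ≠ 0 := by
        intro h
        have : (s + c - 1).re = 0 := by rw [h]; simp
        simp at this; linarith
      exact neg_ne_zero.mpr (mul_ne_zero h2 h1))
    (by
      intro σ hσ
      refine mul_ne_zero (mul_ne_zero hC0 ?_) (Complex.exp_ne_zero _)
      have := zeta1_ne_zero_real (σ := σ + c - 1) (by linarith)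
      push_cast at this
      exact this)
    (by
      intro s hs
      have hw : 1 < (s + c - 1).re := by simp; linarith
      have e1 : (s + c - 1) * s * (Phi G1 s - Phi G2 s) + -((s + c - 1) * s) * Phi G s =
          (s + c - 1) * s * ∫ x in Set.Ioi (2:ℝ), (FI c x : ℂ) * (x:ℂ) ^ (-s - 1) := by
        rw [hF s hs]; ring
      rw [e1, FI_transform hc hs]
      set w := s + c - 1
      have hne : w ≠ 1 := by intro h; rw [h] at hw; simp at hw
      have hne' : w - 1 ≠ 0 := sub_ne_zero.mpr hne
      have hz := riemannZeta_eq_inv_sub_mul hne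
      have e2 : Pfun w - (li 2 : ℂ) * (2:ℂ) ^ (-w) - Phi Gm w =
          (Pfun w + Rfun w) + (-Rfun w - (li 2 : ℂ) * (2:ℂ) ^ (-w)) + (-Phi Gm w) := by ring
      rw [e2, Complex.exp_add, Complex.exp_add (Pfun w + Rfun w), exp_P_R hw, hM w hw, hz,
        Complex.exp_add _ (E w)]
      field_simp)
  intro ρ hρ h0
  refine key (ρ - c + 1) ?_ ?_
  · simp; linarith
  · have : ρ - c + 1 + c - 1 = ρ := by ring
    rw [this, h0]; ring

theorem integral_pi_sub_li_div_rpow_pos_frequently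
    (homega : 1 / 2 < omegaZ) (homega' : omegaZ ≤ 1)
    (c : ℝ) (hc : c < 1 + omegaZ) :
    ∀ X : ℝ, ∃ x : ℝ, x > X ∧ (∫ t in (2:ℝ)..x, (primePi t - li t) / t ^ c) > 0 := by
  intro X
  by_contra hcon
  push Not at hcon
  have hneg : ∀ x, max X 2 < x → FI c x ≤ 0 := by
    intro x hx
    rw [← FI_eq c ((le_max_right X 2).trans hx.le)]
    exact hcon x ((le_max_left X 2).trans_lt hx)
  have hno := no_zero_of_nonpos (c := c) (by linarith) (le_max_right X 2) hneg
  have hlt : max (1 / 2) (c - 1) < omegaZ := max_lt homega (by linarith)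
  have hne : {r : ℝ | ∃ s : ℂ, riemannZeta s = 0 ∧ s.re = r}.Nonempty := by
    by_contra h
    rw [Set.not_nonempty_iff_eq_empty] at h
    unfold omegaZ at homega
    rw [h, Real.sSup_empty] at homega
    norm_num at homega
  obtain ⟨r, ⟨ρ, hρ, rfl⟩, hr⟩ := exists_lt_of_lt_csSup hne hlt
  have hρ1 : ρ ≠ 1 := by
    rintro rfl
    exact riemannZeta_ne_zero_of_one_le_re (by simp) hρ
  have hz := riemannZeta_eq_inv_sub_mul hρ1
  rw [hρ] at hz
  have : (ρ - 1)⁻¹ ≠ 0 := inv_ne_zero (sub_ne_zero.mpr hρ1)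
  exact hno ρ hr ((mul_eq_zero.mp hz.symm).resolve_left this)
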